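/- arXiv:2603.05443 — 2 statements merged into one kernel-verified Lean document; each statement's English description precedes it below -/
import Mathlib

section
/- Let X be a nonempty finite set, let k ≥ 2 be an integer, and let F ⊆ 2^X be a k-cross-free family. Then there exists a weakly-k-cross-free family F' ⊆ 2^X with |F'| ≥ |F| / 2. -/
open Finset

/-- Two subsets `A` and `B` of a ground set `X` are crossing if none of the four sets
`A \ B`, `B \ A`, `A ∩ B`, `X \ (A ∪ B)` is empty. -/
def Crossing {α : Type*} [DecidableEq α] (X A B : Finset α) : Prop :=
  (A \ B).Nonempty ∧ (B \ A).Nonempty ∧ (A ∩ B).Nonempty ∧ (X \ (A ∪ B)).Nonempty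

/-- A family `F ⊆ 2^X` is `k`-cross-free if it contains no `k` members that are
pairwise crossing. -/
def CrossFreeFam {α : Type*} [DecidableEq α] (k : ℕ) (X : Finset α)
    (F : Finset (Finset α)) : Prop :=
  ¬ ∃ S : Finset (Finset α), S ⊆ F ∧ S.card = k ∧
      (S : Set (Finset α)).Pairwise (Crossing X)

/-- Two subsets `A` and `B` are weakly-crossing if none of the three sets
`A ∩ B`, `A \ B`, `B \ A` is empty. -/
def WeaklyCrossing {α : Type*} [DecidableEq α] (A B : Finset α) : Prop :=
  (A ∩ B).Nonempty ∧ (A \ B).Nonempty ∧ (B \ A).Nonempty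

/-- A family is weakly-`k`-cross-free if it contains no `k` members that are
pairwise weakly-crossing. -/
def WeaklyCrossFreeFam {α : Type*} [DecidableEq α] (k : ℕ)
    (F : Finset (Finset α)) : Prop :=
  ¬ ∃ S : Finset (Finset α), S ⊆ F ∧ S.card = k ∧
      (S : Set (Finset α)).Pairwise WeaklyCrossing

/-- Complementation within `X` is injective on subsets of `X`. -/
theorem injOn_sdiff_of_subset {α : Type*} [DecidableEq α] {X : Finset α}
    {F : Finset (Finset α)} (hFX : ∀ A ∈ F, A ⊆ X) :
    Set.InjOn (X \ ·) (F : Set (Finset α)) := fun A hA B hB h => by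
  rw [← Finset.sdiff_sdiff_eq_self (hFX A hA), ← Finset.sdiff_sdiff_eq_self (hFX B hB)]
  exact congrArg (X \ ·) h

theorem Crossing.of_weaklyCrossing {α : Type*} [DecidableEq α] {X A B : Finset α} {x : α}
    (hx : x ∈ X) (hA : x ∉ A) (hB : x ∉ B) (h : WeaklyCrossing A B) : Crossing X A B :=
  ⟨h.2.1, h.2.2, h.1, x, by simp [hx, hA, hB]⟩

theorem Crossing.sdiff {α : Type*} [DecidableEq α] {X A B : Finset α}
    (hA : A ⊆ X) (hB : B ⊆ X) (h : Crossing X A B) : Crossing X (X \ A) (X \ B) := by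
  obtain ⟨⟨a, ha⟩, ⟨b, hb⟩, ⟨c, hc⟩, ⟨d, hd⟩⟩ := h
  simp only [mem_sdiff, mem_inter, mem_union, not_or] at ha hb hc hd
  refine ⟨⟨b, ?_⟩, ⟨a, ?_⟩, ⟨d, ?_⟩, ⟨c, ?_⟩⟩
  · simp [hb, hB hb.1]
  · simp [ha, hA ha.1]
  · simp [hd]
  · simp [hc, hA hc.1]

/-- Complementing all members of a family of subsets of `X` preserves being `k`-cross-free. -/
theorem CrossFreeFam.image_sdiff {α : Type*} [DecidableEq α] {k : ℕ} {X : Finset α}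
    {F : Finset (Finset α)} (hFX : ∀ A ∈ F, A ⊆ X) (hF : CrossFreeFam k X F) :
    CrossFreeFam k X (F.image (X \ ·)) := by
  rintro ⟨S, hS, hcard, hcross⟩
  have hSX : ∀ A ∈ S, A ⊆ X := fun A hA => by
    obtain ⟨B, -, rfl⟩ := mem_image.1 (hS hA)
    exact sdiff_subset
  refine hF ⟨S.image (X \ ·), ?_, (card_image_of_injOn (injOn_sdiff_of_subset hSX)).trans hcard, ?_⟩
  · intro A hA
    obtain ⟨B, hB, rfl⟩ := mem_image.1 hA
    obtain ⟨C, hC, rfl⟩ := mem_image.1 (hS hB)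
    rwa [Finset.sdiff_sdiff_eq_self (hFX C hC)]
  · intro A hA B hB hne
    obtain ⟨C, hC, rfl⟩ := mem_image.1 (mem_coe.1 hA)
    obtain ⟨D, hD, rfl⟩ := mem_image.1 (mem_coe.1 hB)
    exact (hcross hC hD fun h => hne (congrArg (X \ ·) h)).sdiff (hSX C hC) (hSX D hD)

theorem CrossFreeFam.mono {α : Type*} [DecidableEq α] {k : ℕ} {X : Finset α}
    {F G : Finset (Finset α)} (hGF : G ⊆ F) (hF : CrossFreeFam k X F) : CrossFreeFam k X G :=
  fun ⟨S, hS, h⟩ => hF ⟨S, hS.trans hGF, h⟩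

theorem CrossFreeFam.weaklyCrossFreeFam {α : Type*} [DecidableEq α] {k : ℕ} {X : Finset α}
    {F : Finset (Finset α)} {x : α} (hx : x ∈ X) (hxF : ∀ A ∈ F, x ∉ A)
    (hF : CrossFreeFam k X F) : WeaklyCrossFreeFam k F :=
  fun ⟨S, hS, hcard, hcross⟩ => hF ⟨S, hS, hcard, fun _ hA _ hB hne =>
    .of_weaklyCrossing hx (hxF _ (hS hA)) (hxF _ (hS hB)) (hcross hA hB hne)⟩

theorem cross_free_to_weakly_cross_free {α : Type*} [DecidableEq α]
    (X : Finset α) (hX : X.Nonempty) (k : ℕ) (hk : 2 ≤ k)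
    (F : Finset (Finset α)) (hFX : ∀ A ∈ F, A ⊆ X) (hF : CrossFreeFam k X F) :
    ∃ F' : Finset (Finset α), (∀ A ∈ F', A ⊆ X) ∧ WeaklyCrossFreeFam k F' ∧
      (F.card : ℝ) / 2 ≤ F'.card := by
  obtain ⟨x, hx⟩ := hX
  have hsum : ((F.filter (x ∈ ·)).card : ℝ) + (F.filter (x ∉ ·)).card = F.card := by
    exact_mod_cast card_filter_add_card_filter_not (s := F) (x ∈ ·)
  rcases le_total ((F.filter (x ∈ ·)).card : ℝ) (F.filter (x ∉ ·)).card with h | h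
  · exact ⟨F.filter (x ∉ ·), fun A hA => hFX A (mem_filter.1 hA).1,
      (hF.mono (filter_subset _ _)).weaklyCrossFreeFam hx fun A hA => (mem_filter.1 hA).2,
      by linarith⟩
  · have hGX : ∀ A ∈ F.filter (x ∈ ·), A ⊆ X := fun A hA => hFX A (mem_filter.1 hA).1
    refine ⟨(F.filter (x ∈ ·)).image (X \ ·), ?_,
      ((hF.mono (filter_subset _ _)).image_sdiff hGX).weaklyCrossFreeFam hx ?_, ?_⟩
    · intro A hA
      obtain ⟨B, -, rfl⟩ := mem_image.1 hA
      exact sdiff_subset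
    · intro A hA
      obtain ⟨B, hB, rfl⟩ := mem_image.1 hA
      simp [(mem_filter.1 hB).2]
    · rw [card_image_of_injOn (injOn_sdiff_of_subset hGX)]
      linarith
end

section
/- Let X be a finite set, let k ≥ 3 be an integer, let G ⊆ 2^X be a weakly-k-cross-free family, and let F ⊆ G be a subfamily such that: (i) every A ∈ F has |A| ≥ 3; (ii) every A ∈ F is exceptional with respect to G, i.e. there exist distinct elements x, y ∈ X \ A with A ∪ {x} ∈ G and A ∪ {y} ∈ G; and (iii) there are no two distinct sets A, B ∈ F with |A| = |B| and |A △ B| = 2. Then F is weakly-(k−1)-cross-free. -/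
open Finset

theorem WeaklyCrossing.symm {α : Type*} [DecidableEq α] {A B : Finset α}
    (h : WeaklyCrossing A B) : WeaklyCrossing B A :=
  ⟨inter_comm A B ▸ h.1, h.2.2, h.2.1⟩

theorem not_weaklyCrossing_self {α : Type*} [DecidableEq α] (A : Finset α) :
    ¬ WeaklyCrossing A A := fun h => by simpa using h.2.1

/-- Adding a point to `A` preserves weak crossing with `B` if `B \ A` has at least two points. -/
theorem WeaklyCrossing.insert_left {α : Type*} [DecidableEq α] {A B : Finset α}
    (h : WeaklyCrossing A B) (hBA : 1 < (B \ A).card) (x : α) :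
    WeaklyCrossing (insert x A) B := by
  refine ⟨h.1.mono (inter_subset_inter_right (subset_insert x A)),
    h.2.1.mono (sdiff_subset_sdiff (subset_insert x A) subset_rfl), ?_⟩
  obtain ⟨z, hz, hzx⟩ := exists_mem_ne hBA x
  exact ⟨z, by simp_all⟩

/-- Two distinct one-point extensions of a nonempty set are weakly-crossing. -/
theorem weaklyCrossing_insert_insert {α : Type*} [DecidableEq α] {A : Finset α}
    (hA : A.Nonempty) {x y : α} (hx : x ∉ A) (hy : y ∉ A) (hxy : x ≠ y) :
    WeaklyCrossing (insert x A) (insert y A) := by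
  obtain ⟨a, ha⟩ := hA
  exact ⟨⟨a, by simp [ha]⟩, ⟨x, by simp [hx, hxy]⟩, ⟨y, by simp [hy, hxy.symm]⟩⟩

/-- If `A` is no larger than `B`, and the two cross weakly without having the same size and
symmetric difference of size 2, then `B \ A` has at least two points. -/
theorem WeaklyCrossing.one_lt_card_sdiff {α : Type*} [DecidableEq α] {A B : Finset α}
    (h : WeaklyCrossing A B) (hcard : A.card ≤ B.card)
    (hAB : ¬(A.card = B.card ∧ (A \ B ∪ B \ A).card = 2)) : 1 < (B \ A).card := by
  by_contra hlt
  have hA := card_sdiff_add_card_inter A B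
  have hB := card_sdiff_add_card_inter B A
  rw [inter_comm] at hB
  have hApos := h.2.1.card_pos
  have hunion : (A \ B ∪ B \ A).card = (A \ B).card + (B \ A).card :=
    card_union_of_disjoint disjoint_sdiff_sdiff
  exact hAB ⟨by omega, by omega⟩

/-- A subfamily of exceptional sets of size at least 3, no two of which have the same
size and symmetric difference of size 2, is weakly-`(k-1)`-cross-free. -/
theorem exceptional_subfamily_weakly_cross_free {α : Type*} [DecidableEq α]
    (X : Finset α) (k : ℕ) (hk : 3 ≤ k)
    (G : Finset (Finset α)) (hGX : ∀ A ∈ G, A ⊆ X)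
    (hG : WeaklyCrossFreeFam k G)
    (F : Finset (Finset α)) (hFG : F ⊆ G)
    (h1 : ∀ A ∈ F, 3 ≤ A.card)
    (h2 : ∀ A ∈ F, ∃ x ∈ X \ A, ∃ y ∈ X \ A, x ≠ y ∧
      insert x A ∈ G ∧ insert y A ∈ G)
    (h3 : ∀ A ∈ F, ∀ B ∈ F, A ≠ B →
      ¬(A.card = B.card ∧ (A \ B ∪ B \ A).card = 2)) :
    WeaklyCrossFreeFam (k - 1) F := by
  rintro ⟨S, hSF, hSk, hS⟩
  obtain ⟨A, hA, hmin⟩ := exists_min_image S card (card_pos.mp (by omega))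
  obtain ⟨x, hx, y, hy, hxy, hxG, hyG⟩ := h2 A (hSF hA)
  have hcross : ∀ z, ∀ B ∈ S.erase A, WeaklyCrossing (insert z A) B := by
    intro z B hB
    obtain ⟨hBA, hBS⟩ := mem_erase.mp hB
    have hAB := hS hA hBS hBA.symm
    exact hAB.insert_left (hAB.one_lt_card_sdiff (hmin B hBS)
      (h3 A (hSF hA) B (hSF hBS) hBA.symm)) z
  have hxyA : WeaklyCrossing (insert x A) (insert y A) :=
    weaklyCrossing_insert_insert (card_pos.mp (by have := h1 A (hSF hA); omega))
      (mem_sdiff.mp hx).2 (mem_sdiff.mp hy).2 hxy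
  have hnotMem : ∀ z, insert z A ∉ S.erase A :=
    fun z hz => not_weaklyCrossing_self _ (hcross z _ hz)
  have hne : insert x A ≠ insert y A :=
    fun h => not_weaklyCrossing_self _ (h ▸ hxyA)
  refine hG ⟨insert (insert x A) (insert (insert y A) (S.erase A)), ?_, ?_, ?_⟩
  · exact insert_subset hxG (insert_subset hyG
      ((erase_subset A S).trans (hSF.trans hFG)))
  · rw [card_insert_of_notMem (by simpa [mem_insert, hne] using hnotMem x),
      card_insert_of_notMem (hnotMem y), card_erase_of_mem hA]
    omega
  · rw [coe_insert, coe_insert]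
    refine ((hS.mono (coe_subset.mpr (erase_subset A S))).insert ?_).insert ?_
    · exact fun B hB _ => ⟨hcross y B hB, (hcross y B hB).symm⟩
    · rintro B (rfl | hB) _
      · exact ⟨hxyA, hxyA.symm⟩
      · exact ⟨hcross x B hB, (hcross x B hB).symm⟩
end
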